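/- Let n ≥ 2 and P a Sylow 2-subgroup of S_{2ⁿ}. Then P has a unique maximal subgroup of the form W ≀ V, where W is a Sylow 2-subgroup of a symmetric group on 2^{n−2} letters and V ≅ C₂ × C₂ acts regularly on the four copies of W. -/

import Mathlib

/-- `H ≤ Sym(Fin 2ⁿ)` is of the form `W ≀ V`: there is a partition of `{1,…,2ⁿ}` into four
blocks of size `2^{n-2}`, a Sylow 2-subgroup `Wᵢ` of the symmetric group on each block,
and a Klein four-group `V` permuting the blocks (and the corresponding copies of `W`)
regularly, with `H` generated by the base group and `V`. -/
def IsWreathKleinForm (n : ℕ) (H : Subgroup (Equiv.Perm (Fin (2 ^ n)))) : Prop :=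
  ∃ B : Fin 4 → Finset (Fin (2 ^ n)),
    (∀ i j, i ≠ j → Disjoint (B i) (B j)) ∧
    (Finset.univ.biUnion B = Finset.univ) ∧
    (∀ i, (B i).card = 2 ^ (n - 2)) ∧
    ∃ W : Fin 4 → Subgroup (Equiv.Perm (Fin (2 ^ n))),
      (∀ i, ∀ g ∈ W i, ∀ x : Fin (2 ^ n), x ∉ B i → g x = x) ∧
      (∀ i, IsPGroup 2 (W i)) ∧
      (∀ i, Nat.card (W i) = 2 ^ ((2 ^ (n - 2)).factorial.factorization 2)) ∧
      ∃ V : Subgroup (Equiv.Perm (Fin (2 ^ n))),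
        Nat.card V = 4 ∧
        (∀ v ∈ V, v * v = 1) ∧
        (∀ i j : Fin 4, ∃! v : Equiv.Perm (Fin (2 ^ n)),
          v ∈ V ∧ (B i).image ⇑v = B j) ∧
        (∀ v ∈ V, ∀ i j : Fin 4, (B i).image ⇑v = B j →
          (W i).map (MulAut.conj v).toMonoidHom = W j) ∧
        H = (⨆ i, W i) ⊔ V


open Equiv

/-- A Sylow `p`-subgroup of a group acting transitively on a set of `p`-power size is
transitive. -/
theorem wk_sylow_transitive {G X : Type*} [Group G] [Finite G] [Finite X] [MulAction G X]
    [MulAction.IsPretransitive G X] {p m : ℕ} [hp : Fact p.Prime] (hX : Nat.card X = p ^ m)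
    (P : Sylow p G) (x y : X) : ∃ g ∈ P, g • x = y := by
  have h1 : (MulAction.stabilizer G x).index = p ^ m := by
    rw [MulAction.index_stabilizer_of_transitive, hX]
  have hcop : Nat.Coprime (p ^ m) (P : Subgroup G).index :=
    Nat.Coprime.pow_left _ ((Nat.Prime.coprime_iff_not_dvd hp.out).2 P.not_dvd_index)
  set S := MulAction.stabilizer G x with hS
  have h2 : p ^ m ∣ (S ⊓ (P : Subgroup G)).index := by
    rw [← h1]; exact Subgroup.index_dvd_of_le inf_le_left
  have h3 : (S ⊓ (P : Subgroup G)).index = S.relIndex P * (P : Subgroup G).index := by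
    rw [← Subgroup.relIndex_mul_index (inf_le_right : S ⊓ (P : Subgroup G) ≤ P),
      Subgroup.inf_relIndex_right]
  rw [h3] at h2
  have h4 : p ^ m ∣ S.relIndex P := hcop.dvd_of_dvd_mul_right h2
  have h5 : MulAction.stabilizer P x = S.subgroupOf P := by
    ext g; simp [hS, Subgroup.mem_subgroupOf, MulAction.mem_stabilizer_iff, Subgroup.smul_def]
  have h6 : (MulAction.orbit P x).ncard = S.relIndex P := by
    rw [← MulAction.index_stabilizer, h5]; rfl
  have h7 : p ^ m ≤ (MulAction.orbit P x).ncard := by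
    rw [h6]; refine Nat.le_of_dvd (Nat.pos_of_ne_zero ?_) h4
    exact Subgroup.index_ne_zero_of_finite
  have h8 : MulAction.orbit P x = Set.univ := by
    apply Set.eq_of_subset_of_ncard_le (Set.subset_univ _)
    rw [Set.ncard_univ, hX]; exact h7
  have h9 : y ∈ MulAction.orbit P x := by rw [h8]; trivial
  obtain ⟨g, hg⟩ := h9
  exact ⟨g, g.2, hg⟩

theorem wk_apply_inv {α : Type*} (g : Perm α) (x : α) : g (g⁻¹ x) = x := by simp

theorem wk_le_range {α : Type*} [DecidableEq α] (B : Finset α)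
    (W : Subgroup (Perm α)) (hW : ∀ g ∈ W, ∀ x, x ∉ B → g x = x) :
    W ≤ (Perm.ofSubtype : Perm {x // x ∈ B} →* Perm α).range := by
  intro g hg
  exact ⟨_, (congrArg Subtype.val
    ((Perm.subtypeEquivSubtypePerm (fun x => x ∈ B)).apply_symm_apply ⟨g, hW g hg⟩))⟩

theorem wk_block_transitive {α : Type*} [Finite α] [DecidableEq α] (B : Finset α) {m : ℕ}
    (hB : B.card = 2 ^ m) (W : Subgroup (Perm α)) (hW : ∀ g ∈ W, ∀ x, x ∉ B → g x = x)
    (hc : Nat.card W = 2 ^ ((2 ^ m).factorial.factorization 2)) {x y : α}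
    (hx : x ∈ B) (hy : y ∈ B) : ∃ g ∈ W, g x = y := by
  have hr := wk_le_range B W hW
  let f : Perm {x // x ∈ B} →* Perm α := Perm.ofSubtype
  have hcard : Nat.card (W.comap f) = Nat.card W := by
    rw [Nat.card_congr ((W.comap f).equivMapOfInjective f Perm.ofSubtype_injective).toEquiv,
      Subgroup.map_comap_eq_self hr]
  let S : Sylow 2 (Perm {x // x ∈ B}) := Sylow.ofCard (W.comap f) (by
    rw [hcard, hc, Nat.card_perm]; simp [hB])
  obtain ⟨g, hg, hgx⟩ := wk_sylow_transitive (m := m) (by simp [hB]) S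
    (⟨x, hx⟩ : {x // x ∈ B}) ⟨y, hy⟩
  refine ⟨f g, hg, ?_⟩
  have : f g x = g ⟨x, hx⟩ := Perm.ofSubtype_apply_of_mem g hx
  rw [this]
  exact congrArg Subtype.val hgx

theorem wk_block_maximal {α : Type*} [Finite α] [DecidableEq α] (B : Finset α) {m : ℕ}
    (hB : B.card = 2 ^ m) (W N : Subgroup (Perm α)) (hWN : W ≤ N)
    (hN : ∀ g ∈ N, ∀ x, x ∉ B → g x = x)
    (hp : IsPGroup 2 N)
    (hc : Nat.card W = 2 ^ ((2 ^ m).factorial.factorization 2)) : N ≤ W := by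
  have hr := wk_le_range B N hN
  obtain ⟨k, hk⟩ := (IsPGroup.iff_card (p := 2)).1 hp
  have hd : Nat.card N ∣ (2 ^ m).factorial := by
    have h := Subgroup.card_dvd_of_le hr
    have h2 : Nat.card (Perm.ofSubtype : Perm {x // x ∈ B} →* Perm α).range
        = (2 ^ m).factorial := by
      rw [← Nat.card_congr (MonoidHom.ofInjective
        (Perm.ofSubtype_injective (p := fun x => x ∈ B))).toEquiv, Nat.card_perm]
      simp [hB]
    rwa [h2] at h
  have hle : Nat.card N ≤ Nat.card W := by
    rw [hc, hk]
    apply Nat.pow_le_pow_right (by norm_num)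
    rw [hk] at hd
    exact (Nat.Prime.pow_dvd_iff_le_factorization Nat.prime_two (Nat.factorial_ne_zero _)).1 hd
  exact (Subgroup.eq_of_le_of_card_ge hWN hle).ge

/-- The restriction of a `2`-element normalising the block lies in the Sylow subgroup. -/
theorem wk_restrict {α : Type*} [Finite α] [DecidableEq α] (B : Finset α) {m : ℕ}
    (hB : B.card = 2 ^ m) (W P : Subgroup (Perm α)) (hWP : W ≤ P) (hP : IsPGroup 2 P)
    (hW : ∀ g ∈ W, ∀ x, x ∉ B → g x = x)
    (hc : Nat.card W = 2 ^ ((2 ^ m).factorial.factorization 2))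
    (g : Perm α) (hg : g ∈ P) (hgB : ∀ x, g x ∈ B ↔ x ∈ B) :
    ∃ h ∈ W, ∀ x ∈ B, h x = g x := by
  let N : Subgroup (Perm α) :=
    { carrier := {h | (∀ x, x ∉ B → h x = x) ∧
        ∃ g ∈ P, (∀ x, g x ∈ B ↔ x ∈ B) ∧ ∀ x ∈ B, h x = g x}
      one_mem' := ⟨fun _ _ => rfl, 1, P.one_mem, fun _ => Iff.rfl, fun _ _ => rfl⟩
      mul_mem' := by
        rintro a b ⟨ha, g, hg, hgB, hag⟩ ⟨hb, g', hg', hgB', hbg⟩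
        refine ⟨fun x hx => ?_, g * g', P.mul_mem hg hg', fun x => ?_, fun x hx => ?_⟩
        · rw [Perm.mul_apply, hb x hx, ha x hx]
        · rw [Perm.mul_apply, hgB, hgB']
        · rw [Perm.mul_apply, Perm.mul_apply, hbg x hx, hag _ ((hgB' x).2 hx)]
      inv_mem' := by
        rintro a ⟨ha, g, hg, hgB, hag⟩
        have hinv : ∀ x, g⁻¹ x ∈ B ↔ x ∈ B := fun x => by
          rw [← hgB (g⁻¹ x), wk_apply_inv]
        refine ⟨fun x hx => ?_, g⁻¹, P.inv_mem hg, hinv, fun x hx => ?_⟩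
        · rw [Perm.inv_eq_iff_eq, ha x hx]
        · rw [Perm.inv_eq_iff_eq, hag _ ((hinv x).2 hx), wk_apply_inv] }
  have hWN : W ≤ N := fun h hh => by
    refine ⟨hW h hh, h, hWP hh, fun x => ?_, fun _ _ => rfl⟩
    by_cases hx : x ∈ B
    · refine ⟨fun _ => hx, fun _ => ?_⟩
      by_contra hcon
      have := hW h hh _ hcon
      rw [h.injective this] at hcon
      exact hcon hx
    · rw [hW h hh x hx]
  have hNp : IsPGroup 2 N := by
    rintro ⟨h, hh, g, hg, hgB, hhg⟩
    obtain ⟨k, hk⟩ := hP ⟨g, hg⟩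
    have hk' : g ^ 2 ^ k = 1 := congrArg Subtype.val hk
    refine ⟨k, Subtype.ext ?_⟩
    change h ^ 2 ^ k = 1
    have key : ∀ r : ℕ, ∀ x, (x ∉ B → (h ^ r) x = x) ∧
        (x ∈ B → (h ^ r) x = (g ^ r) x ∧ (g ^ r) x ∈ B) := by
      intro r
      induction r with
      | zero => intro x; simp
      | succ r ih =>
        intro x
        refine ⟨fun hx => ?_, fun hx => ?_⟩
        · rw [pow_succ', Perm.mul_apply, (ih x).1 hx, hh x hx]
        · rw [pow_succ', pow_succ', Perm.mul_apply, Perm.mul_apply, ((ih x).2 hx).1,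
            hhg _ ((ih x).2 hx).2]
          exact ⟨rfl, (hgB _).2 ((ih x).2 hx).2⟩
    ext x
    by_cases hx : x ∈ B
    · rw [((key _ x).2 hx).1, hk']
    · rw [(key _ x).1 hx]; rfl
  have hNW := wk_block_maximal B hB W N hWN (fun h hh => hh.1) hNp hc
  refine ⟨Perm.ofSubtype (p := fun x => x ∈ B) (g.subtypePerm (p := fun x => x ∈ B) hgB),
    hNW ⟨fun x hx => Perm.ofSubtype_apply_of_not_mem _ hx, g, hg, hgB, fun x hx => ?_⟩,
    fun x hx => ?_⟩ <;> · rw [Perm.ofSubtype_apply_of_mem _ hx]; rfl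

/-- Assembling a permutation from its restrictions to the four blocks. -/
theorem wk_assemble {α : Type*} (β : α → Fin 4) (W : Fin 4 → Subgroup (Perm α))
    (hW : ∀ i, ∀ g ∈ W i, ∀ x, β x ≠ i → g x = x) (g : Perm α) (hg : ∀ x, β (g x) = β x)
    (hr : ∀ i, ∃ h ∈ W i, ∀ x, β x = i → h x = g x) : g ∈ ⨆ i, W i := by
  choose h hh hhg using hr
  have : g = h 0 * (h 1 * (h 2 * h 3)) := by
    ext x
    simp only [Perm.mul_apply]
    have hgx := hg x
    have h4 : ∀ i : Fin 4, i = 0 ∨ i = 1 ∨ i = 2 ∨ i = 3 := by decide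
    rcases h4 (β x) with hx | hx | hx | hx
    · rw [hW 3 _ (hh 3) x (by rw [hx]; decide), hW 2 _ (hh 2) x (by rw [hx]; decide),
        hW 1 _ (hh 1) x (by rw [hx]; decide), hhg 0 x hx]
    · rw [hW 3 _ (hh 3) x (by rw [hx]; decide), hW 2 _ (hh 2) x (by rw [hx]; decide),
        hhg 1 x hx, hW 0 _ (hh 0) (g x) (by rw [hgx, hx]; decide)]
    · rw [hW 3 _ (hh 3) x (by rw [hx]; decide), hhg 2 x hx,
        hW 1 _ (hh 1) (g x) (by rw [hgx, hx]; decide),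
        hW 0 _ (hh 0) (g x) (by rw [hgx, hx]; decide)]
    · rw [hhg 3 x hx, hW 2 _ (hh 2) (g x) (by rw [hgx, hx]; decide),
        hW 1 _ (hh 1) (g x) (by rw [hgx, hx]; decide),
        hW 0 _ (hh 0) (g x) (by rw [hgx, hx]; decide)]
  rw [this]
  have hm : ∀ i, h i ∈ ⨆ i, W i := fun i => Subgroup.mem_iSup_of_mem i (hh i)
  exact mul_mem (hm 0) (mul_mem (hm 1) (mul_mem (hm 2) (hm 3)))

/-- The data of a `W ≀ V` structure in terms of a labelling of the points by the blocks. -/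
structure WkData (n : ℕ) (H : Subgroup (Perm (Fin (2 ^ n)))) (β : Fin (2 ^ n) → Fin 4)
    (W : Fin 4 → Subgroup (Perm (Fin (2 ^ n)))) (V : Subgroup (Perm (Fin (2 ^ n)))) : Prop where
  fib : ∀ i, (Finset.univ.filter (fun x => β x = i)).card = 2 ^ (n - 2)
  supp : ∀ i, ∀ g ∈ W i, ∀ x, β x ≠ i → g x = x
  cardW : ∀ i, Nat.card (W i) = 2 ^ ((2 ^ (n - 2)).factorial.factorization 2)
  sq : ∀ v ∈ V, v * v = 1
  perm : ∀ v ∈ V, ∃ σ : Perm (Fin 4), ∀ x, β (v x) = σ (β x)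
  trans : ∀ i j, ∃ v ∈ V, ∀ x, β x = i → β (v x) = j
  free : ∀ v ∈ V, ∀ i, (∀ x, β x = i → β (v x) = i) → v = 1
  eq : H = (⨆ i, W i) ⊔ V

theorem wk_data_of_form {n : ℕ} {H : Subgroup (Perm (Fin (2 ^ n)))}
    (h : IsWreathKleinForm n H) : ∃ β W V, WkData n H β W V := by
  obtain ⟨B, hdis, hun, hcard, W, hsupp, -, hcW, V, hcV, hsq, hreg, -, hH⟩ := h
  have hex : ∀ x, ∃ i, x ∈ B i := fun x => by
    have : x ∈ Finset.univ.biUnion B := by rw [hun]; simp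
    simpa using this
  choose β hβ using hex
  have hβi : ∀ x i, x ∈ B i ↔ β x = i := fun x i => by
    refine ⟨fun hx => ?_, fun hx => hx ▸ hβ x⟩
    by_contra hne
    exact Finset.disjoint_left.1 (hdis _ _ hne) (hβ x) hx
  have hne : ∀ i, (B i).Nonempty := fun i => by
    rw [← Finset.card_pos, hcard]; positivity
  have hinj : Function.Injective B := fun i j hij => by
    obtain ⟨x, hx⟩ := hne i
    have h1 := (hβi x i).1 hx
    have h2 := (hβi x j).1 (hij ▸ hx)
    rw [← h1, h2]
  have himg : ∀ (v : Perm (Fin (2 ^ n))) i j,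
      (B i).image v = B j ↔ ∀ x, β x = i → β (v x) = j := fun v i j => by
    constructor
    · intro h x hx
      rw [← hβi, ← h]
      exact Finset.mem_image_of_mem _ ((hβi _ _).2 hx)
    · intro h
      apply Finset.eq_of_subset_of_card_le
      · intro y hy
        obtain ⟨x, hx, rfl⟩ := Finset.mem_image.1 hy
        exact (hβi _ _).2 (h x ((hβi _ _).1 hx))
      · rw [Finset.card_image_of_injective _ v.injective, hcard, hcard]
  have hall : ∀ v ∈ V, ∀ i, ∃ j, (B i).image v = B j := by
    intro v hv i
    choose f hf _ using fun j => hreg i j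
    have hfi : Function.Injective (fun j => (⟨f j, (hf j).1⟩ : V)) := by
      intro j k hjk
      have : f j = f k := congrArg Subtype.val hjk
      apply hinj
      rw [← (hf j).2, ← (hf k).2, this]
    have hbij := (Nat.bijective_iff_injective_and_card (fun j => (⟨f j, (hf j).1⟩ : V))).2
      ⟨hfi, by rw [hcV]; simp⟩
    obtain ⟨j, hj⟩ := hbij.2 ⟨v, hv⟩
    have : f j = v := congrArg Subtype.val hj
    exact ⟨j, this ▸ (hf j).2⟩
  refine ⟨β, W, V, ?_, ?_, hcW, hsq, ?_, ?_, ?_, hH⟩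
  · intro i
    rw [← hcard i]
    congr 1
    ext x
    simp [hβi]
  · intro i g hg x hx
    exact hsupp i g hg x (fun h => hx ((hβi _ _).1 h))
  · intro v hv
    choose s hs using hall v hv
    have hsinj : Function.Injective s := by
      intro i j hij
      apply hinj
      apply Finset.image_injective v.injective
      rw [hs, hs, hij]
    exact ⟨Equiv.ofBijective s (Finite.injective_iff_bijective.1 hsinj),
      fun x => (himg v _ _).1 (hs _) x rfl⟩
  · intro i j
    obtain ⟨v, hv, -⟩ := hreg i j
    exact ⟨v, hv.1, (himg _ _ _).1 hv.2⟩
  · intro v hv i hvi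
    obtain ⟨w, hw, hu⟩ := hreg i i
    rw [hu v ⟨hv, (himg _ _ _).2 hvi⟩, hu 1 ⟨V.one_mem, (himg _ _ _).2 (fun x hx => hx)⟩]

theorem wk_W_perm {n : ℕ} {H : Subgroup (Perm (Fin (2 ^ n)))} {β W V} (d : WkData n H β W V)
    {i : Fin 4} {w : Perm (Fin (2 ^ n))} (hw : w ∈ W i) (x : Fin (2 ^ n)) : β (w x) = β x := by
  by_cases hx : β x = i
  · by_contra hne
    have h := d.supp i w hw (w x) (by rw [← hx]; exact hne)
    rw [w.injective h] at hne
    exact hne rfl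
  · rw [d.supp i w hw x hx]

theorem wk_H_perm {n : ℕ} {H : Subgroup (Perm (Fin (2 ^ n)))} {β W V} (d : WkData n H β W V) :
    ∀ h ∈ H, ∃ σ : Perm (Fin 4), ∀ x, β (h x) = σ (β x) := by
  let S : Subgroup (Perm (Fin (2 ^ n))) :=
    { carrier := {h | ∃ σ : Perm (Fin 4), ∀ x, β (h x) = σ (β x)}
      one_mem' := ⟨1, fun x => rfl⟩
      mul_mem' := by
        rintro a b ⟨σ, hσ⟩ ⟨τ, hτ⟩
        exact ⟨σ * τ, fun x => by simp [hσ, hτ]⟩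
      inv_mem' := by
        rintro a ⟨σ, hσ⟩
        refine ⟨σ⁻¹, fun x => ?_⟩
        rw [eq_comm, Perm.inv_eq_iff_eq, ← hσ, wk_apply_inv] }
  have hS : H ≤ S := by
    rw [d.eq]
    refine sup_le (iSup_le fun i w hw => ⟨1, fun x => wk_W_perm d hw x⟩) (fun v hv => d.perm v hv)
  exact fun h hh => hS hh

theorem wk_label_unique {n : ℕ} {H : Subgroup (Perm (Fin (2 ^ n)))} {β W V}
    (d : WkData n H β W V) (γ : Fin (2 ^ n) → Fin 4)
    (hγ : ∀ i, (Finset.univ.filter (fun x => γ x = i)).card = 2 ^ (n - 2))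
    (hH : ∀ h ∈ H, ∃ σ : Perm (Fin 4), ∀ x, γ (h x) = σ (γ x)) :
    ∃ ρ : Perm (Fin 4), ∀ x, γ x = ρ (β x) := by
  have hfac : ∀ x y, β x = β y → γ x = γ y := by
    intro x y hxy
    by_cases hz : ∃ z, γ z = γ x ∧ β z ≠ β x
    · obtain ⟨z, hz1, hz2⟩ := hz
      obtain ⟨w, hw, hwx⟩ := wk_block_transitive _ (d.fib (β x)) (W (β x))
        (fun g hg z hz => d.supp _ g hg z (by simpa using hz)) (d.cardW _)
        (x := x) (y := y) (by simp) (by simp [hxy])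
      have hwH : w ∈ H := by
        rw [d.eq]; exact Subgroup.mem_sup_left (Subgroup.mem_iSup_of_mem _ hw)
      obtain ⟨σ, hσ⟩ := hH w hwH
      have h1 := hσ z
      rw [d.supp _ w hw z hz2, hz1] at h1
      rw [← hwx, hσ x, ← h1]
    · push Not at hz
      have hsub : Finset.univ.filter (fun z => γ z = γ x) ⊆
          Finset.univ.filter (fun z => β z = β x) := by
        intro z hz'
        simp only [Finset.mem_filter, Finset.mem_univ, true_and] at hz' ⊢
        exact hz z hz'
      have heq := Finset.eq_of_subset_of_card_le hsub (by rw [d.fib, hγ])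
      have hy : y ∈ Finset.univ.filter (fun z => β z = β x) := by simp [hxy]
      rw [← heq] at hy
      simp only [Finset.mem_filter, Finset.mem_univ, true_and] at hy
      exact hy.symm
  have hsurj : ∀ i, ∃ x, β x = i := fun i => by
    have : (Finset.univ.filter (fun x => β x = i)).Nonempty := by
      rw [← Finset.card_pos, d.fib]; positivity
    obtain ⟨x, hx⟩ := this
    exact ⟨x, by simpa using hx⟩
  have hsurjγ : ∀ i, ∃ x, γ x = i := fun i => by
    have : (Finset.univ.filter (fun x => γ x = i)).Nonempty := by
      rw [← Finset.card_pos, hγ]; positivity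
    obtain ⟨x, hx⟩ := this
    exact ⟨x, by simpa using hx⟩
  choose s hs using hsurj
  have hρ : ∀ x, γ x = γ (s (β x)) := fun x => hfac _ _ (hs _).symm
  have hρs : Function.Surjective (fun i => γ (s i)) := fun j => by
    obtain ⟨x, hx⟩ := hsurjγ j
    exact ⟨β x, by rw [← hx, hρ x]⟩
  exact ⟨Equiv.ofBijective _ (Finite.surjective_iff_bijective.1 hρs), hρ⟩

theorem wk_P_perm {n : ℕ} {H P : Subgroup (Perm (Fin (2 ^ n)))} {β W V}
    (d : WkData n H β W V) (hHP : H ≤ P) (hidx : (H.subgroupOf P).index = 2) :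
    ∀ g ∈ P, ∃ σ : Perm (Fin 4), ∀ x, β (g x) = σ (β x) := by
  intro g hg
  have hnorm := Subgroup.normal_of_index_eq_two hidx
  apply wk_label_unique d (fun x => β (g x))
  · intro i
    rw [← d.fib i]
    apply Finset.card_bij (fun x _ => g x)
    · intro x hx; simpa using hx
    · intro x _ y _ h; exact g.injective h
    · intro y hy
      exact ⟨g⁻¹ y, by simpa using hy, by simp⟩
  · intro h hh
    have hc := hnorm.conj_mem ⟨h, hHP hh⟩ hh ⟨g, hg⟩
    have hc' : g * h * g⁻¹ ∈ H := hc
    obtain ⟨σ, hσ⟩ := wk_H_perm d _ hc'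
    refine ⟨σ, fun x => ?_⟩
    have := hσ (g x)
    simpa using this

theorem wk_kernel {n : ℕ} {H P : Subgroup (Perm (Fin (2 ^ n)))} {β W V}
    (d : WkData n H β W V) (hHP : H ≤ P) (hP : IsPGroup 2 P) (g : Perm (Fin (2 ^ n)))
    (hg : g ∈ P) (hgβ : ∀ x, β (g x) = β x) : g ∈ ⨆ i, W i := by
  refine wk_assemble β W d.supp g hgβ fun i => ?_
  have hWP : W i ≤ P := le_trans (by rw [d.eq]; exact le_sup_of_le_left (le_iSup W i)) hHP
  obtain ⟨h, hh, hhg⟩ := wk_restrict _ (d.fib i) (W i) P hWP hP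
    (fun g hg z hz => d.supp _ g hg z (by simpa using hz)) (d.cardW i) g hg (by simp [hgβ])
  exact ⟨h, hh, fun x hx => hhg x (by simpa using hx)⟩

theorem wk_fpf : ∀ σ τ : Perm (Fin 4), σ * σ = 1 → τ * τ = 1 → (∀ i, σ i ≠ i) →
    (∀ i, τ i ≠ i) → σ 0 = τ 0 → σ = τ := by
  decide

theorem wk_le {n : ℕ} {P H₁ H₂ : Subgroup (Perm (Fin (2 ^ n)))} {β₁ W₁ V₁ β₂ W₂ V₂}
    (hP : IsPGroup 2 P)
    (d₁ : WkData n H₁ β₁ W₁ V₁) (hHP₁ : H₁ ≤ P)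
    (d₂ : WkData n H₂ β₂ W₂ V₂) (hHP₂ : H₂ ≤ P) (hidx₂ : (H₂.subgroupOf P).index = 2) :
    H₁ ≤ H₂ := by
  have hP₂ := wk_P_perm d₂ hHP₂ hidx₂
  obtain ⟨ρ, hρ⟩ := wk_label_unique d₁ β₂ d₂.fib (fun h hh => hP₂ h (hHP₁ hh))
  have hK : (⨆ i, W₂ i) ≤ H₂ := by rw [d₂.eq]; exact le_sup_left
  have hV₂ : V₂ ≤ H₂ := by rw [d₂.eq]; exact le_sup_right
  have hsurj : ∀ i, ∃ x, β₂ x = i := fun i => by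
    have : (Finset.univ.filter (fun x => β₂ x = i)).Nonempty := by
      rw [← Finset.card_pos, d₂.fib]; positivity
    obtain ⟨x, hx⟩ := this
    exact ⟨x, by simpa using hx⟩
  have hsqσ : ∀ (v : Perm (Fin (2 ^ n))) (σ : Perm (Fin 4)), v * v = 1 →
      (∀ x, β₂ (v x) = σ (β₂ x)) → σ * σ = 1 := by
    intro v σ hv hσ
    ext i
    obtain ⟨x, rfl⟩ := hsurj i
    rw [Perm.mul_apply, ← hσ, ← hσ, ← Perm.mul_apply v v, hv]; rfl
  rw [d₁.eq]
  refine sup_le (iSup_le fun i w hw => ?_) (fun v hv => ?_)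
  · have hwH : w ∈ H₁ := by
      rw [d₁.eq]; exact Subgroup.mem_sup_left (Subgroup.mem_iSup_of_mem _ hw)
    exact hK (wk_kernel d₂ hHP₂ hP w (hHP₁ hwH) (fun x => by rw [hρ, hρ, wk_W_perm d₁ hw]))
  · by_cases hv1 : v = 1
    · rw [hv1]; exact H₂.one_mem
    have hvP : v ∈ P := hHP₁ (by rw [d₁.eq]; exact Subgroup.mem_sup_right hv)
    obtain ⟨σ, hσ⟩ := hP₂ v hvP
    have hσf : ∀ i, σ i ≠ i := by
      intro i hi
      apply hv1
      apply d₁.free v hv (ρ.symm i)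
      intro x hx
      have h1 := hσ x
      rw [hρ, hρ x, hx, Equiv.apply_symm_apply, hi] at h1
      rw [← h1, Equiv.symm_apply_apply]
    obtain ⟨v', hv', hvz⟩ := d₂.trans 0 (σ 0)
    obtain ⟨τ, hτ⟩ := d₂.perm v' hv'
    obtain ⟨x0, hx0⟩ := hsurj 0
    have h0 : σ 0 = τ 0 := by rw [← hvz x0 hx0, hτ, hx0]
    have hτf : ∀ i, τ i ≠ i := by
      intro i hi
      have h1 : v' = 1 := d₂.free v' hv' i (fun x hx => by rw [hτ, hx, hi])
      apply hσf 0
      rw [← hvz x0 hx0, h1]; exact hx0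
    have hst := wk_fpf σ τ (hsqσ v σ (d₁.sq v hv) hσ) (hsqσ v' τ (d₂.sq v' hv') hτ) hσf hτf h0
    have hvv : v' * v ∈ ⨆ i, W₂ i := by
      refine wk_kernel d₂ hHP₂ hP _ (P.mul_mem (hHP₂ (hV₂ hv')) hvP) fun x => ?_
      rw [Perm.mul_apply, hτ, hσ, hst, ← Perm.mul_apply, hsqσ v' τ (d₂.sq v' hv') hτ]; rfl
    have := H₂.mul_mem (H₂.inv_mem (hV₂ hv')) (hK hvv)
    rwa [inv_mul_cancel_left] at this

/-- The Klein four-group. -/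
abbrev WkQ : Type := Multiplicative (ZMod 2 × ZMod 2)

open RegularWreathProduct in
/-- Representation of the wreath product on `Fin (2 ^ n)`. -/
noncomputable def wkPhi {n : ℕ} {D : Subgroup (Perm (Fin (2 ^ (n - 2))))}
    (e : Fin (2 ^ (n - 2)) × WkQ ≃ Fin (2 ^ n)) : (D ≀ᵣ WkQ) →* Perm (Fin (2 ^ n)) :=
  e.permCongrHom.toMonoidHom.comp (toPerm D WkQ (Fin (2 ^ (n - 2))))

theorem wkPhi_apply {n : ℕ} {D : Subgroup (Perm (Fin (2 ^ (n - 2))))}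
    (e : Fin (2 ^ (n - 2)) × WkQ ≃ Fin (2 ^ n)) (w : D ≀ᵣ WkQ) (x : Fin (2 ^ n)) :
    wkPhi e w x = e ((w.left (w.right * (e.symm x).2) : Perm _) (e.symm x).1,
      w.right * (e.symm x).2) := rfl

theorem wkPhi_injective {n : ℕ} {D : Subgroup (Perm (Fin (2 ^ (n - 2))))}
    (e : Fin (2 ^ (n - 2)) × WkQ ≃ Fin (2 ^ n)) : Function.Injective (wkPhi (D := D) e) :=
  (e.permCongrHom.injective).comp (RegularWreathProduct.toPermInj _ _ _)

/-- The inclusion of the copy of `D` with index `q`. -/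
def wkIota {D : Type*} [Group D] (q : WkQ) : D →* D ≀ᵣ WkQ where
  toFun d := ⟨Pi.mulSingle q d, 1⟩
  map_one' := by ext <;> simp
  map_mul' a b := by
    apply RegularWreathProduct.ext
    · funext x; simp [Pi.mulSingle_mul]
    · simp

theorem wkIota_injective {D : Type*} [Group D] (q : WkQ) :
    Function.Injective (wkIota (D := D) q) := fun _ _ h =>
  Pi.mulSingle_injective q (congrArg RegularWreathProduct.left h)

theorem wk_iota_conj {D : Type*} [Group D] (q a : WkQ) (d : D) :
    RegularWreathProduct.inl q * wkIota a d * (RegularWreathProduct.inl q)⁻¹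
      = wkIota (q * a) d := by
  apply RegularWreathProduct.ext
  · funext x
    simp only [RegularWreathProduct.mul_left, RegularWreathProduct.left_inl, wkIota,
      MonoidHom.coe_mk, OneHom.coe_mk, Pi.mul_apply, Pi.one_apply, one_mul,
      RegularWreathProduct.inv_left, Pi.inv_apply, inv_one, mul_one,
      RegularWreathProduct.right_inl, Pi.mulSingle_apply]
    simp only [inv_mul_eq_iff_eq_mul]
  · simp [wkIota]

theorem wk_form {n : ℕ} (S : Sylow 2 (Perm (Fin (2 ^ (n - 2)))))
    (e : Fin (2 ^ (n - 2)) × WkQ ≃ Fin (2 ^ n)) :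
    IsWreathKleinForm n (wkPhi (D := (S : Subgroup (Perm (Fin (2 ^ (n - 2)))))) e).range := by
  classical
  have hQ : Nat.card WkQ = 4 := by simp [WkQ]
  let c : WkQ ≃ Fin 4 := Finite.equivFinOfCardEq hQ
  let β : Fin (2 ^ n) → Fin 4 := fun x => c (e.symm x).2
  let D := (S : Subgroup (Perm (Fin (2 ^ (n - 2)))))
  let φ : (D ≀ᵣ WkQ) →* Perm (Fin (2 ^ n)) := wkPhi e
  have hφ : Function.Injective φ := wkPhi_injective e
  let W : Fin 4 → Subgroup (Perm (Fin (2 ^ n))) := fun i => (φ.comp (wkIota (c.symm i))).range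
  let V : Subgroup (Perm (Fin (2 ^ n))) := (φ.comp RegularWreathProduct.inl).range
  have hβφ : ∀ w x, β (φ w x) = c (w.right * c.symm (β x)) := by
    intro w x
    simp only [β, φ, wkPhi_apply, Equiv.symm_apply_apply]
  have hsupp : ∀ i, ∀ g ∈ W i, ∀ x, β x ≠ i → g x = x := by
    rintro i _ ⟨d, rfl⟩ x hx
    have hne : (e.symm x).2 ≠ c.symm i := fun h => hx (by simp [β, h])
    change wkPhi e (wkIota (c.symm i) d) x = x
    rw [wkPhi_apply]
    simp [wkIota, Pi.mulSingle_eq_of_ne hne]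
  have hcardS : Nat.card D = 2 ^ ((2 ^ (n - 2)).factorial.factorization 2) := by
    have := S.card_eq_multiplicity
    rw [Nat.card_perm, Nat.card_fin] at this
    exact this
  have hcW : ∀ i, Nat.card (W i) = 2 ^ ((2 ^ (n - 2)).factorial.factorization 2) := by
    intro i
    rw [← hcardS]
    exact (Nat.card_congr (MonoidHom.ofInjective
      (f := φ.comp (wkIota (c.symm i))) (hφ.comp (wkIota_injective _))).toEquiv).symm
  have hinl : Function.Injective (φ.comp (RegularWreathProduct.inl (D := D) (Q := WkQ))) :=
    hφ.comp (fun _ _ h => congrArg RegularWreathProduct.right h)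
  have hsurj : ∀ i, ∃ x, β x = i := fun i =>
    ⟨e (⟨0, by positivity⟩, c.symm i), by simp [β]⟩
  have himg : ∀ (q : WkQ) (i j : Fin 4),
      (Finset.univ.filter (fun x => β x = i)).image (φ (RegularWreathProduct.inl q))
        = Finset.univ.filter (fun x => β x = j) ↔ q * c.symm i = c.symm j := by
    intro q i j
    constructor
    · intro h
      obtain ⟨x, hx⟩ := hsurj i
      have h1 : φ (RegularWreathProduct.inl q) x ∈ Finset.univ.filter (fun x => β x = j) := by
        rw [← h]; exact Finset.mem_image_of_mem _ (by simp [hx])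
      simp only [Finset.mem_filter, Finset.mem_univ, true_and, hβφ, hx,
        RegularWreathProduct.right_inl] at h1
      rw [← h1, Equiv.symm_apply_apply]
    · intro h
      ext y
      simp only [Finset.mem_image, Finset.mem_filter, Finset.mem_univ, true_and]
      constructor
      · rintro ⟨x, hx, rfl⟩
        rw [hβφ, hx, RegularWreathProduct.right_inl, h, Equiv.apply_symm_apply]
      · intro hy
        refine ⟨φ (RegularWreathProduct.inl q)⁻¹ y, ?_, ?_⟩
        · rw [hβφ, hy, ← h]; simp
        · rw [map_inv, wk_apply_inv]
  refine ⟨fun i => Finset.univ.filter (fun x => β x = i), ?_, ?_, ?_, W, ?_, ?_, hcW, V,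
    ?_, ?_, ?_, ?_, ?_⟩
  · intro i j hij
    rw [Finset.disjoint_left]
    intro x hx hx'
    simp only [Finset.mem_filter, Finset.mem_univ, true_and] at hx hx'
    exact hij (hx ▸ hx')
  · ext x; simp
  · intro i
    rw [← Fintype.card_fin (2 ^ (n - 2)), ← Finset.card_univ]
    symm
    apply Finset.card_bij (fun y _ => e (y, c.symm i))
    · intro y _; simp [β]
    · intro y _ z _ h; simpa using h
    · intro x hx
      refine ⟨(e.symm x).1, Finset.mem_univ _, ?_⟩
      simp only [Finset.mem_filter, Finset.mem_univ, true_and, β] at hx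
      rw [← hx, Equiv.symm_apply_apply, Prod.mk.eta, Equiv.apply_symm_apply]
  · intro i g hg x hx
    exact hsupp i g hg x (by simpa using hx)
  · intro i
    exact IsPGroup.of_card (hcW i)
  · rw [← hQ]
    exact (Nat.card_congr (MonoidHom.ofInjective hinl).toEquiv).symm
  · rintro _ ⟨q, rfl⟩
    rw [← map_mul]
    have : q * q = 1 := by revert q; decide
    rw [this, map_one]
  · intro i j
    refine ⟨φ (RegularWreathProduct.inl (c.symm j * (c.symm i)⁻¹)), ⟨⟨_, rfl⟩, ?_⟩, ?_⟩
    · rw [himg]; simp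
    · rintro _ ⟨⟨q, rfl⟩, hq⟩
      have := (himg q i j).1 hq
      rw [← this, mul_inv_cancel_right]; rfl
  · rintro _ ⟨q, rfl⟩ i j hij
    have hq := (himg q i j).1 hij
    ext g
    constructor
    · rintro ⟨_, ⟨d, rfl⟩, rfl⟩
      refine ⟨d, ?_⟩
      change φ _ = φ _ * φ _ * (φ _)⁻¹
      rw [← hq, ← map_mul, ← map_inv, ← map_mul, wk_iota_conj]
    · rintro ⟨d, rfl⟩
      refine ⟨_, ⟨d, rfl⟩, ?_⟩
      change φ _ * φ _ * (φ _)⁻¹ = φ _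
      rw [← hq, ← map_mul, ← map_inv, ← map_mul, wk_iota_conj]
  · apply le_antisymm
    · rintro _ ⟨w, rfl⟩
      have hw : w = ⟨w.left, 1⟩ * RegularWreathProduct.inl w.right := by ext <;> simp
      rw [hw, map_mul]
      refine mul_mem (Subgroup.mem_sup_left ?_) (Subgroup.mem_sup_right ⟨w.right, rfl⟩)
      refine wk_assemble β W hsupp _ (fun x => ?_) (fun i => ?_)
      · exact (hβφ _ x).trans (by simp)
      · refine ⟨_, ⟨w.left (c.symm i), rfl⟩, fun x hx => ?_⟩
        have hx' : (e.symm x).2 = c.symm i := by rw [← hx]; simp [β]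
        change wkPhi e (wkIota _ _) x = _
        rw [wkPhi_apply, wkPhi_apply]
        simp [wkIota, hx']
    · refine sup_le (iSup_le fun i => ?_) ?_
      · rintro _ ⟨d, rfl⟩; exact ⟨_, rfl⟩
      · rintro _ ⟨d, rfl⟩; exact ⟨_, rfl⟩

theorem wk_fact (k : ℕ) : (2 ^ k).factorial.factorization 2 + 1 = 2 ^ k := by
  rw [← Nat.multiplicity_eq_factorization Nat.prime_two (Nat.factorial_ne_zero _),
    Nat.Prime.multiplicity_factorial_pow Nat.prime_two]
  have := Nat.geomSum_eq (le_refl 2) k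
  have h := Nat.one_le_two_pow (n := k)
  omega

theorem wk_exists {n : ℕ} (hn : 2 ≤ n) (P : Sylow 2 (Perm (Fin (2 ^ n)))) :
    ∃ H : Subgroup (Perm (Fin (2 ^ n))), H ≤ (P : Subgroup (Perm (Fin (2 ^ n)))) ∧
      (H.subgroupOf (P : Subgroup (Perm (Fin (2 ^ n))))).index = 2 ∧
      IsWreathKleinForm n H := by
  have hQ : Nat.card WkQ = 4 := by simp [WkQ]
  have h4 : 4 * 2 ^ (n - 2) = 2 ^ n := by
    obtain ⟨k, rfl⟩ := Nat.exists_eq_add_of_le hn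
    rw [Nat.add_sub_cancel_left, pow_add]; norm_num
  obtain ⟨S⟩ : Nonempty (Sylow 2 (Perm (Fin (2 ^ (n - 2))))) := inferInstance
  let e : Fin (2 ^ (n - 2)) × WkQ ≃ Fin (2 ^ n) := Finite.equivFinOfCardEq (by
    rw [Nat.card_prod, hQ, Nat.card_fin, mul_comm, h4])
  let D := (S : Subgroup (Perm (Fin (2 ^ (n - 2)))))
  have hcardS : Nat.card D = 2 ^ ((2 ^ (n - 2)).factorial.factorization 2) := by
    have := S.card_eq_multiplicity
    rw [Nat.card_perm, Nat.card_fin] at this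
    exact this
  have hcardP : Nat.card P = 2 ^ ((2 ^ n).factorial.factorization 2) := by
    have := P.card_eq_multiplicity
    rw [Nat.card_perm, Nat.card_fin] at this
    exact this
  have hcH : ∀ e : Fin (2 ^ (n - 2)) × WkQ ≃ Fin (2 ^ n),
      Nat.card (wkPhi (D := D) e).range = 2 ^ ((2 ^ n).factorial.factorization 2 - 1) := by
    intro e
    rw [← Nat.card_congr (MonoidHom.ofInjective (wkPhi_injective (D := D) e)).toEquiv,
      RegularWreathProduct.card, hQ, hcardS, ← pow_mul, show (4 : ℕ) = 2 ^ 2 by norm_num,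
      ← pow_add]
    congr 1
    have h1 := wk_fact n
    have h2 := wk_fact (n - 2)
    omega
  obtain ⟨R, hR⟩ := (IsPGroup.of_card (hcH e)).exists_le_sylow
  obtain ⟨g, hg⟩ := MulAction.exists_smul_eq (Perm (Fin (2 ^ n))) R P
  have hle : (wkPhi (D := D) (e.trans g)).range ≤ (P : Subgroup (Perm (Fin (2 ^ n)))) := by
    rintro _ ⟨w, rfl⟩
    rw [← hg]
    refine ⟨wkPhi e w, hR ⟨w, rfl⟩, ?_⟩
    ext x
    rfl
  refine ⟨(wkPhi (D := D) (e.trans g)).range, hle, ?_, wk_form S _⟩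
  have hm := Subgroup.card_mul_index
    ((wkPhi (D := D) (e.trans g)).range.subgroupOf (P : Subgroup (Perm (Fin (2 ^ n)))))
  rw [Nat.card_congr (Subgroup.subgroupOfEquivOfLe hle).toEquiv, hcH, hcardP] at hm
  have h1 := wk_fact n
  have h5 := Nat.one_le_two_pow (n := n - 2)
  obtain ⟨k, hk⟩ : ∃ k, (2 ^ n).factorial.factorization 2 = k + 1 :=
    ⟨(2 ^ n).factorial.factorization 2 - 1, by omega⟩
  rw [hk, Nat.add_sub_cancel, pow_succ] at hm
  exact Nat.eq_of_mul_eq_mul_left (by positivity) hm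

/-- For `n ≥ 2`, a Sylow 2-subgroup of `S_{2ⁿ}` has a unique maximal subgroup of the form
`W ≀ V` with `W` a Sylow 2-subgroup of a symmetric group on `2^{n-2}` letters and
`V ≅ C₂ × C₂` acting regularly on the four copies of `W`. -/
theorem unique_wreath_klein_maximal {n : ℕ} (hn : 2 ≤ n)
    (P : Sylow 2 (Equiv.Perm (Fin (2 ^ n)))) :
    ∃! H : Subgroup (Equiv.Perm (Fin (2 ^ n))),
      H ≤ (P : Subgroup (Equiv.Perm (Fin (2 ^ n)))) ∧
      (H.subgroupOf (P : Subgroup (Equiv.Perm (Fin (2 ^ n))))).index = 2 ∧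
      IsWreathKleinForm n H := by
  obtain ⟨H, hH⟩ := wk_exists hn P
  refine ⟨H, hH, ?_⟩
  rintro H' ⟨hle', hidx', hform'⟩
  obtain ⟨hle, hidx, hform⟩ := hH
  obtain ⟨β, W, V, d⟩ := wk_data_of_form hform
  obtain ⟨β', W', V', d'⟩ := wk_data_of_form hform'
  exact le_antisymm (wk_le P.isPGroup' d' hle' d hle hidx) (wk_le P.isPGroup' d hle d' hle' hidx')
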